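/- arXiv:math/0212004 — 2 statements merged into one kernel-verified Lean document; each statement's English description precedes it below -/
import Mathlib

section
/- Let α and β both be generators of Fˣ, and define v_α(s,k) = s + (α^k − 1)/(α − 1) and v_β(t,ℓ) = t + (β^ℓ − 1)/(β − 1) for elements s, t ∈ F and integers k, ℓ. If a, b ∈ F with a ≠ 0 and the affine map φ(x) = a·x + b satisfies φ(v_α(s, k+i)) = v_β(t, ℓ+i) for i = 0, 1, 2, then β = α. (Hence an affine automorphism of F carrying three consecutive vertices of a polygon of C_q^α to three consecutive vertices, in the same cyclic order, of a polygon of C_q^β forces β = α.) -/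
/-- Heffter's vertex function: `v_γ(s,k) = s + (γ^k - 1)/(γ - 1)`. -/
noncomputable def heffterV {F : Type*} [Field F] (γ s : F) (k : ℤ) : F :=
  s + (γ ^ k - 1) / (γ - 1)

/-- If every nonzero element of a finite field with more than two elements is an integer
power of `γ`, then `γ` is neither `0` nor `1`. -/
theorem ne_zero_and_ne_one_of_forall_exists_zpow {F : Type*} [Field F] [Fintype F]
    (hcard : 2 < Fintype.card F) {γ : F} (hγ : ∀ x : F, x ≠ 0 → ∃ k : ℤ, γ ^ k = x) :
    γ ≠ 0 ∧ γ ≠ 1 := by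
  obtain ⟨x, hx0, hx1⟩ : ∃ x : F, x ≠ 0 ∧ x ≠ 1 := by
    by_contra! h
    obtain ⟨u, v, w, huv, huw, hvw⟩ := Fintype.two_lt_card_iff.mp hcard
    have h' (x : F) : x = 0 ∨ x = 1 := or_iff_not_imp_left.mpr (h x)
    rcases h' u with rfl | rfl <;> rcases h' v with rfl | rfl <;>
      rcases h' w with rfl | rfl <;> contradiction
  obtain ⟨k, rfl⟩ := hγ x hx0
  refine ⟨?_, ?_⟩
  · rintro rfl
    rcases eq_or_ne k 0 with rfl | hk
    · exact hx1 (zpow_zero _)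
    · exact hx0 (zero_zpow k hk)
  · rintro rfl
    exact hx1 (one_zpow k)

/-- The difference of two consecutive Heffter vertices is a power of `γ`. -/
theorem heffterV_add_one_sub {F : Type*} [Field F] {γ : F} (h0 : γ ≠ 0) (h1 : γ ≠ 1)
    (s : F) (k : ℤ) : heffterV γ s (k + 1) - heffterV γ s k = γ ^ k := by
  have h : γ - 1 ≠ 0 := sub_ne_zero.mpr h1
  rw [heffterV, heffterV, zpow_add_one₀ h0]
  field_simp
  ring

/-- If an affine map `φ(x) = a·x + b` (`a ≠ 0`) carries three consecutive vertices of a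
polygon of the Heffter cellulation `C_q^α` to three consecutive vertices, in the same
cyclic order, of a polygon of `C_q^β`, then `β = α`. -/
theorem heffter_affine_order_preserving {F : Type*} [Field F] [Fintype F] (q : ℕ)
    (hcard : Fintype.card F = q) (hq4 : q % 4 = 1) (hq5 : 5 ≤ q)
    (α β : F) (hα : ∀ x : F, x ≠ 0 → ∃ k : ℤ, α ^ k = x)
    (hβ : ∀ x : F, x ≠ 0 → ∃ k : ℤ, β ^ k = x)
    (a b : F) (ha : a ≠ 0) (s t : F) (k ℓ : ℤ)
    (h0 : a * heffterV α s k + b = heffterV β t ℓ)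
    (h1 : a * heffterV α s (k + 1) + b = heffterV β t (ℓ + 1))
    (h2 : a * heffterV α s (k + 2) + b = heffterV β t (ℓ + 2)) :
    β = α := by
  have hq2 : 2 < Fintype.card F := by omega
  obtain ⟨hα0, hα1⟩ := ne_zero_and_ne_one_of_forall_exists_zpow hq2 hα
  obtain ⟨hβ0, hβ1⟩ := ne_zero_and_ne_one_of_forall_exists_zpow hq2 hβ
  have e0 : a * α ^ k = β ^ ℓ := by
    rw [← heffterV_add_one_sub hα0 hα1 s, ← heffterV_add_one_sub hβ0 hβ1 t]
    linear_combination h1 - h0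
  have e1 : a * α ^ (k + 1) = β ^ (ℓ + 1) := by
    rw [← heffterV_add_one_sub hα0 hα1 s, ← heffterV_add_one_sub hβ0 hβ1 t,
      add_assoc, add_assoc, one_add_one_eq_two]
    linear_combination h2 - h1
  rw [zpow_add_one₀ hα0, zpow_add_one₀ hβ0, ← mul_assoc, e0] at e1
  exact (mul_left_cancel₀ (zpow_ne_zero ℓ hβ0) e1).symm
end

section
/- Let α and β both be generators of Fˣ, and define v_α(s,k) = s + (α^k − 1)/(α − 1) and v_β(t,ℓ) = t + (β^ℓ − 1)/(β − 1) for elements s, t ∈ F and integers k, ℓ. If a, b ∈ F with a ≠ 0 and the affine map φ(x) = a·x + b satisfies φ(v_α(s, k+i)) = v_β(t, ℓ−i) for i = 0, 1, 2, then β = α⁻¹. (Hence an affine automorphism of F carrying three consecutive vertices of a polygon of C_q^α to three consecutive vertices, in reversed cyclic order, of a polygon of C_q^β forces β = 1/α; together with the order-preserving case this shows the cellulations C_q^α and C_q^β are combinatorially distinct whenever β ∉ {α, 1/α}.) -/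
/-- If an affine map `φ(x) = a·x + b` (`a ≠ 0`) carries three consecutive vertices of a
polygon of the Heffter cellulation `C_q^α` to three consecutive vertices, in reversed
cyclic order, of a polygon of `C_q^β`, then `β = α⁻¹`. -/
theorem heffter_affine_order_reversing {F : Type*} [Field F] [Fintype F] (q : ℕ)
    (hcard : Fintype.card F = q) (hq4 : q % 4 = 1) (hq5 : 5 ≤ q)
    (α β : F) (hα : ∀ x : F, x ≠ 0 → ∃ k : ℤ, α ^ k = x)
    (hβ : ∀ x : F, x ≠ 0 → ∃ k : ℤ, β ^ k = x)
    (a b : F) (ha : a ≠ 0) (s t : F) (k ℓ : ℤ)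
    (h0 : a * heffterV α s k + b = heffterV β t ℓ)
    (h1 : a * heffterV α s (k + 1) + b = heffterV β t (ℓ - 1))
    (h2 : a * heffterV α s (k + 2) + b = heffterV β t (ℓ - 2)) :
    β = α⁻¹ := by
  obtain ⟨hα0, hα1⟩ := ne_zero_and_ne_one_of_forall_exists_zpow (by omega) hα
  obtain ⟨hβ0, hβ1⟩ := ne_zero_and_ne_one_of_forall_exists_zpow (by omega) hβ
  have hαk := heffterV_add_one_sub hα0 hα1 s k
  have hαk' := heffterV_add_one_sub hα0 hα1 s (k + 1)
  have hβℓ := heffterV_add_one_sub hβ0 hβ1 t (ℓ - 1)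
  have hβℓ' := heffterV_add_one_sub hβ0 hβ1 t (ℓ - 2)
  rw [show k + 1 + 1 = k + 2 by ring, zpow_add_one₀ hα0] at hαk'
  rw [show ℓ - 1 + 1 = ℓ by ring, show ℓ - 1 = ℓ - 2 + 1 by ring, zpow_add_one₀ hβ0] at hβℓ
  rw [show ℓ - 2 + 1 = ℓ - 1 by ring] at hβℓ hβℓ'
  have hpow : β ^ (ℓ - 2) ≠ 0 := zpow_ne_zero _ hβ0
  have hfirst : a * α ^ k = -(β ^ (ℓ - 2) * β) := by
    linear_combination h1 - h0 - a * hαk - hβℓ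
  have hsecond : a * (α ^ k * α) = -β ^ (ℓ - 2) := by
    linear_combination h2 - h1 - a * hαk' - hβℓ'
  refine eq_inv_of_mul_eq_one_left (mul_left_cancel₀ hpow ?_)
  linear_combination α * hfirst - hsecond
end
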